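/- arXiv:2407.07435 — 2 statements merged into one kernel-verified Lean document; each statement's English description precedes it below -/
import Mathlib

section
/- For every integer n ≥ 3, the second adjoint cohomology of the Lie algebra g_n = sch_n/⟨z⟩ vanishes: every alternating bilinear map φ: g_n × g_n → g_n satisfying the 2-cocycle identity is a 2-coboundary, i.e. H²(g_n, g_n)=0. -/
open scoped BigOperators

/-- Basis index set for the Lie algebra `g_n = sch_n/⟨z⟩`, the quotient of the `n`-th
Schrödinger algebra by its center, with basis `{h, e, f, x_1, …, x_n, y_1, …, y_n}`. -/
inductive GIdx (n : ℕ) : Type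
  | H : GIdx n
  | E : GIdx n
  | F : GIdx n
  | X : Fin n → GIdx n
  | Y : Fin n → GIdx n
  deriving DecidableEq

/-- The underlying vector space of `g_n = sch_n/⟨z⟩`. -/
abbrev G (n : ℕ) : Type := GIdx n → ℂ

/-- The Lie bracket of `g_n`, componentwise; it encodes exactly the relations
`[e,f]=h, [h,e]=2e, [h,f]=-2f, [h,x_i]=x_i, [h,y_i]=-y_i, [e,y_i]=x_i, [f,x_i]=y_i`. -/
noncomputable def brg {n : ℕ} (u v : G n) : G n := fun j =>
  match j with
  | .H => u .E * v .F - u .F * v .E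
  | .E => 2 * (u .H * v .E - u .E * v .H)
  | .F => -2 * (u .H * v .F - u .F * v .H)
  | .X i => (u .H * v (.X i) - u (.X i) * v .H) + (u .E * v (.Y i) - u (.Y i) * v .E)
  | .Y i => -(u .H * v (.Y i) - u (.Y i) * v .H) + (u .F * v (.X i) - u (.X i) * v .F)

/-- The bracket of `g_n` as a bilinear map. -/
noncomputable def brgL (n : ℕ) : G n →ₗ[ℂ] G n →ₗ[ℂ] G n :=
  LinearMap.mk₂ ℂ brg
    (by intro m m' v; funext j; cases j <;> simp only [brg, Pi.add_apply] <;> ring)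
    (by intro c m v; funext j; cases j <;>
      simp only [brg, Pi.smul_apply, smul_eq_mul] <;> ring)
    (by intro m v v'; funext j; cases j <;> simp only [brg, Pi.add_apply] <;> ring)
    (by intro c m v; funext j; cases j <;>
      simp only [brg, Pi.smul_apply, smul_eq_mul] <;> ring)

/-- The basis vector `h` of `g_n`. -/
noncomputable def hG (n : ℕ) : G n := Pi.single GIdx.H 1
/-- The basis vector `e` of `g_n`. -/
noncomputable def eG (n : ℕ) : G n := Pi.single GIdx.E 1
/-- The basis vector `f` of `g_n`. -/
noncomputable def fG (n : ℕ) : G n := Pi.single GIdx.F 1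
/-- The basis vector `x_i` of `g_n`. -/
noncomputable def xG {n : ℕ} (i : Fin n) : G n := Pi.single (GIdx.X i) 1
/-- The basis vector `y_i` of `g_n`. -/
noncomputable def yG {n : ℕ} (i : Fin n) : G n := Pi.single (GIdx.Y i) 1

/-- The subalgebra `sl_2 = span {e, f, h}` of `g_n`. -/
noncomputable def sl2G (n : ℕ) : Submodule ℂ (G n) :=
  Submodule.span ℂ {eG n, fG n, hG n}

/-- Basis index set for the abelian ideal `a = span {x_1, …, x_n, y_1, …, y_n}` of `g_n`. -/
inductive AIdx (n : ℕ) : Type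
  | X : Fin n → AIdx n
  | Y : Fin n → AIdx n
  deriving DecidableEq

/-- The underlying vector space of the abelian ideal `a` of `g_n`. -/
abbrev A (n : ℕ) : Type := AIdx n → ℂ

/-- The natural inclusion `a → g_n`. -/
noncomputable def ιA {n : ℕ} (a : A n) : G n := fun j =>
  match j with
  | .X i => a (.X i)
  | .Y i => a (.Y i)
  | .H => 0
  | .E => 0
  | .F => 0

/-- The action of `v ∈ g_n` on the ideal `a`: `actA v a = [v, a]`, viewed inside `a`
(the ideal `a` is stable under taking brackets with any element). -/
noncomputable def actA {n : ℕ} (v : G n) (a : A n) : A n := fun j =>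
  match j with
  | .X i => brgL n v (ιA a) (GIdx.X i)
  | .Y i => brgL n v (ιA a) (GIdx.Y i)

/-- The (zero) bracket of the abelian ideal `a`. -/
noncomputable def brA {n : ℕ} (a b : A n) : A n := actA (ιA a) b

/-- The basis vector `x_i` of `a`. -/
noncomputable def xA {n : ℕ} (i : Fin n) : A n := Pi.single (AIdx.X i) 1
/-- The basis vector `y_i` of `a`. -/
noncomputable def yA {n : ℕ} (i : Fin n) : A n := Pi.single (AIdx.Y i) 1
namespace Schrodinger

variable {n : ℕ}

instance : Finite (GIdx n) :=
  Finite.of_surjective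
    (fun s : Fin 3 ⊕ Fin n ⊕ Fin n => match s with
      | .inl 0 => GIdx.H
      | .inl 1 => GIdx.E
      | .inl 2 => GIdx.F
      | .inr (.inl i) => GIdx.X i
      | .inr (.inr i) => GIdx.Y i)
    (by
      rintro (_ | _ | _ | i | i)
      exacts [⟨.inl 0, rfl⟩, ⟨.inl 1, rfl⟩, ⟨.inl 2, rfl⟩, ⟨.inr (.inl i), rfl⟩,
        ⟨.inr (.inr i), rfl⟩])

/-- The standard basis vectors of `g_n`. -/
noncomputable def bas (i : GIdx n) : G n := Pi.single i 1

lemma bas_apply (i j : GIdx n) : bas i j = if j = i then 1 else 0 := Pi.single_apply ..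

lemma linearMap_ext_bas {M : Type*} [AddCommGroup M] [Module ℂ M] {S T : G n →ₗ[ℂ] M}
    (h : ∀ i, S (bas i) = T (bas i)) : S = T :=
  LinearMap.pi_ext' fun i => LinearMap.ext_ring (h i)

/-- The linear endomorphism of `g_n` with prescribed values on the standard basis. -/
noncomputable def ofBas (v : GIdx n → G n) : G n →ₗ[ℂ] G n :=
  (Pi.basisFun ℂ (GIdx n)).constr ℂ v

lemma ofBas_bas (v : GIdx n → G n) (i : GIdx n) : ofBas v (bas i) = v i := by
  classical
  have h := (Pi.basisFun ℂ (GIdx n)).constr_basis ℂ v i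
  rwa [Pi.basisFun_apply] at h

/-- The `ad h`-weights of the standard basis vectors. -/
def wt : GIdx n → ℂ
  | .H => 0
  | .E => 2
  | .F => -2
  | .X _ => 1
  | .Y _ => -1

lemma brgL_apply (u v : G n) : brgL n u v = brg u v := rfl

lemma brgL_H (u : G n) (k : GIdx n) : brgL n (bas .H) u k = wt k * u k := by
  cases k <;> simp [brgL_apply, brg, bas_apply, wt]

lemma brgL_H_bas (i : GIdx n) : brgL n (bas .H) (bas i) = wt i • bas i := by
  funext k
  rw [brgL_H, Pi.smul_apply, smul_eq_mul, bas_apply]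
  split_ifs with h
  · rw [h]
  · simp

lemma brgL_skew (u v : G n) : brgL n u v = -brgL n v u := by
  funext k
  cases k <;> simp only [brgL_apply, brg, Pi.neg_apply] <;> ring

lemma brgL_jacobi (u v w : G n) :
    brgL n u (brgL n v w) = brgL n (brgL n u v) w + brgL n v (brgL n u w) := by
  funext k
  cases k <;> simp only [brgL_apply, brg, Pi.add_apply] <;> ring

/-- Brackets of standard basis vectors. -/
noncomputable def basBrg : GIdx n → GIdx n → G n
  | .H, j => wt j • bas j
  | i, .H => -(wt i • bas i)
  | .E, .F => bas .H
  | .F, .E => -bas .H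
  | .E, .Y i => bas (.X i)
  | .Y i, .E => -bas (.X i)
  | .F, .X i => bas (.Y i)
  | .X i, .F => -bas (.Y i)
  | _, _ => 0

lemma brgL_bas (i j : GIdx n) : brgL n (bas i) (bas j) = basBrg i j := by
  funext k
  cases i <;> cases j <;> cases k <;>
    simp [brgL_apply, brg, bas_apply, basBrg, wt, neg_ite]

/-- The cocycle identity for a bilinear map with values in the adjoint module. -/
def IsCocycle (φ : G n →ₗ[ℂ] G n →ₗ[ℂ] G n) : Prop :=
  ∀ a b c, brgL n a (φ b c) + brgL n b (φ c a) + brgL n c (φ a b) +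
    φ a (brgL n b c) + φ b (brgL n c a) + φ c (brgL n a b) = 0

/-- The coboundary of a linear endomorphism of `g_n`. -/
noncomputable def cobdry (ω : G n →ₗ[ℂ] G n) : G n →ₗ[ℂ] G n →ₗ[ℂ] G n :=
  (brgL n).comp ω + (brgL n).compl₂ ω - (brgL n).compr₂ ω

lemma cobdry_apply (ω : G n →ₗ[ℂ] G n) (a b : G n) :
    cobdry ω a b = brgL n (ω a) b + brgL n a (ω b) - ω (brgL n a b) := by
  simp [cobdry]

lemma cobdry_self (ω : G n →ₗ[ℂ] G n) (a : G n) : cobdry ω a a = 0 := by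
  have h : brgL n a a = 0 := by
    funext k
    cases k <;> simp only [brgL_apply, brg, Pi.zero_apply] <;> ring
  rw [cobdry_apply, h, brgL_skew (ω a) a]
  simp

lemma isCocycle_cobdry (ω : G n →ₗ[ℂ] G n) : IsCocycle (cobdry ω) := by
  intro a b c
  have h : ω (brgL n a (brgL n b c)) + ω (brgL n b (brgL n c a)) +
      ω (brgL n c (brgL n a b)) = 0 := by
    rw [← map_add, ← map_add, brgL_jacobi a b c, brgL_skew c (brgL n a b), brgL_skew c a,
      map_neg]
    convert map_zero ω using 2
    abel
  have h' : ∀ u v w : G n, brgL n u (brgL n v w) + brgL n v (brgL n w u) +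
      brgL n w (brgL n u v) = 0 := by
    intro u v w
    rw [brgL_jacobi u v w, brgL_skew w (brgL n u v), brgL_skew w u, map_neg]
    abel
  have h1 := h' (ω a) b c
  have h2 := h' a (ω b) c
  have h3 := h' a b (ω c)
  simp only [cobdry_apply, map_add, map_sub]
  linear_combination (exp := 1) h1 + h2 + h3 - h

lemma IsCocycle.sub {φ ψ : G n →ₗ[ℂ] G n →ₗ[ℂ] G n} (hφ : IsCocycle φ) (hψ : IsCocycle ψ) :
    IsCocycle (φ - ψ) := by
  intro a b c
  have h := congrArg₂ (· - ·) (hφ a b c) (hψ a b c)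
  simp only [sub_zero] at h
  rw [← h]
  simp only [LinearMap.sub_apply, map_sub]
  abel

variable {φ : G n →ₗ[ℂ] G n →ₗ[ℂ] G n}

lemma skew_of_alternating (halt : ∀ a, φ a a = 0) (a b : G n) : φ a b = -φ b a := by
  have h := halt (a + b)
  simp only [map_add, LinearMap.add_apply, halt, zero_add, add_zero] at h
  exact eq_neg_of_add_eq_zero_right h

/-- Up to a coboundary, `φ(h, ·)` commutes with `ad h`. -/
lemma exists_sub_cobdry_commute (halt : ∀ a, φ a a = 0) :
    ∃ ω : G n →ₗ[ℂ] G n, ∀ u, brgL n (bas .H) ((φ - cobdry ω) (bas .H) u) =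
      (φ - cobdry ω) (bas .H) (brgL n (bas .H) u) := by
  refine ⟨ofBas fun j k => φ (bas .H) (bas j) k / (wt k - wt j), fun u => ?_⟩
  set ω := ofBas (n := n) fun j k => φ (bas .H) (bas j) k / (wt k - wt j) with hω
  suffices h : (brgL n (bas .H)).comp ((φ - cobdry ω) (bas .H)) =
      ((φ - cobdry ω) (bas .H)).comp (brgL n (bas .H)) from LinearMap.congr_fun h u
  refine linearMap_ext_bas fun j => ?_
  have hH : ω (bas .H) = 0 := by
    rw [hω, ofBas_bas]
    funext k
    simp [halt]
  funext k
  have hj : ω (bas j) k = φ (bas .H) (bas j) k / (wt k - wt j) := by rw [hω, ofBas_bas]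
  simp only [LinearMap.comp_apply, brgL_H, brgL_H_bas, map_smul, LinearMap.sub_apply,
    cobdry_apply, hH, map_zero, LinearMap.zero_apply, zero_add, Pi.sub_apply, Pi.smul_apply,
    smul_eq_mul, hj]
  by_cases hk : wt k - wt j = 0
  · rw [sub_eq_zero.mp hk]
  · field_simp
    ring

/-- If `φ(h, ·)` commutes with `ad h`, then the cocycle `φ` has weight zero. -/
lemma apply_eq_zero_of_wt_ne (halt : ∀ a, φ a a = 0) (hφ : IsCocycle φ)
    (hcomm : ∀ u, brgL n (bas .H) (φ (bas .H) u) = φ (bas .H) (brgL n (bas .H) u))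
    (i j k : GIdx n) (hk : wt k ≠ wt i + wt j) : φ (bas i) (bas j) k = 0 := by
  set θ := brgL n (φ (bas .H) (bas i)) (bas j) + brgL n (bas i) (φ (bas .H) (bas j)) -
    φ (bas .H) (brgL n (bas i) (bas j)) with hθ
  have h₁ : brgL n (bas .H) θ = (wt i + wt j) • θ := by
    rw [hθ]
    simp only [map_add, map_sub, brgL_jacobi (bas .H), hcomm, brgL_H_bas, map_smul,
      LinearMap.smul_apply]
    module
  have h₂ : brgL n (bas .H) (φ (bas i) (bas j)) = (wt i + wt j) • φ (bas i) (bas j) + θ := by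
    have h := hφ (bas .H) (bas i) (bas j)
    rw [skew_of_alternating halt (bas j) (bas .H), brgL_skew (bas j) (bas .H), brgL_H_bas,
      brgL_H_bas, brgL_skew (bas j), skew_of_alternating halt (bas j)] at h
    simp only [map_neg, map_smul, LinearMap.smul_apply] at h
    rw [← sub_eq_zero, ← h, hθ]
    module
  have e₁ := congrFun h₁ k
  have e₂ := congrFun h₂ k
  simp only [brgL_H, Pi.add_apply, Pi.smul_apply, smul_eq_mul] at e₁ e₂
  have hk' := sub_ne_zero.mpr hk
  have hθk : θ k = 0 :=
    (mul_eq_zero.mp (by linear_combination e₁ : (wt k - (wt i + wt j)) * θ k = 0)).resolve_left hk'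
  exact (mul_eq_zero.mp (by linear_combination e₂ + hθk :
    (wt k - (wt i + wt j)) * φ (bas i) (bas j) k = 0)).resolve_left hk'

/-- The endomorphism whose coboundary is a given cocycle of weight zero. -/
noncomputable def primitive (φ : G n →ₗ[ℂ] G n →ₗ[ℂ] G n) : G n →ₗ[ℂ] G n :=
  let a := φ (bas .H) (bas .E) .E / 2
  let b := φ (bas .E) (bas .F) .H + a
  ofBas fun
    | .H => a • bas .H
    | .E => b • bas .E
    | .F => 0
    | .X i => b • bas (.X i) - φ (bas .E) (bas (.Y i))
    | .Y _ => 0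

lemma eq_cobdry_primitive (halt : ∀ a, φ a a = 0) (hφ : IsCocycle φ)
    (hwt : ∀ i j k, wt k ≠ wt i + wt j → φ (bas i) (bas j) k = 0) :
    φ = cobdry (primitive φ) := by
  have hskew : ∀ i j k, φ (bas i) (bas j) k = -φ (bas j) (bas i) k := fun i j k =>
    congrFun (skew_of_alternating halt (bas i) (bas j)) k
  have key : ∀ p q r k, _ := fun p q r k => congrFun (hφ (bas p) (bas q) (bas r)) k
  simp only [brgL_bas] at key
  have hHEF := key .H .E .F .H
  have hEFX := fun i j => key .E .F (.X i) (.X j)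
  have hEFY := fun i j => key .E .F (.Y i) (.Y j)
  have hHEY := fun i j => key .H .E (.Y i) (.X j)
  have hEXY := fun i j => key .E (.X i) (.Y j) .E
  have hFXY := fun i j => key .F (.X i) (.Y j) .F
  have hXXY := fun i j => key (.X i) (.X j) (.Y i) (.X i)
  simp [brgL_apply, brg, basBrg, bas_apply, wt] at hHEF hEFX hEFY hHEY hEXY hFXY hXXY
  simp only [hskew .F .H, hskew .F .E, hskew (.X _) .H, hskew (.Y _) .H, hskew (.Y _) .E,
    hskew (.Y _) (.X _), halt, Pi.zero_apply] at hHEF hEFX hEFY hHEY hXXY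
  have hR : ∀ i j, φ (bas (.X i)) (bas (.Y j)) .H = 0 := fun i j => by
    have h := hXXY i j
    have h₁ := hEXY i j
    have h₂ := hEXY j i
    have h₃ := hskew (.X i) (.X j) .E
    split_ifs at h with hij
    · subst hij
      linear_combination (h₁ + h₃ / 2) / (-2)
    · linear_combination h / 3 - h₁ / 2 - (h₂ + h₃) / 6
  have hP : ∀ i j, φ (bas (.X i)) (bas (.X j)) .E = 0 := fun i j => by
    linear_combination -hEXY i j - 2 * hR i j
  have hQ : ∀ i j, φ (bas (.Y i)) (bas (.Y j)) .F = 0 := fun i j => by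
    linear_combination hFXY j i - 2 * hR j i
  have hA : ∀ i j, φ (bas .H) (bas (.X i)) (.X j) =
      if j = i then φ (bas .H) (bas .E) .E / 2 else 0 := fun i j => by
    have h₁ := hEFX i j
    have h₂ := hEFY i j
    have h₃ := hHEY i j
    split_ifs at * <;> linear_combination (h₃ - h₁ - h₂) / 2
  have hB : ∀ i j, φ (bas .H) (bas (.Y i)) (.Y j) =
      -if j = i then φ (bas .H) (bas .E) .E / 2 else 0 := fun i j => by
    rw [← hA]
    linear_combination -hEFX i j - hEFY i j
  have hD : ∀ i j, φ (bas .F) (bas (.X i)) (.Y j) =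
      (if j = i then φ (bas .E) (bas .F) .H + φ (bas .H) (bas .E) .E / 2 else 0) -
        φ (bas .E) (bas (.Y i)) (.X j) := fun i j => by
    have h₁ := hEFX i j
    have h₂ := hA i j
    split_ifs at * <;> linear_combination h₁ + h₂
  have hF : φ (bas .H) (bas .F) .F = -φ (bas .H) (bas .E) .E := by
    linear_combination -hHEF
  have hEYH : ∀ i, φ (bas .E) (bas (.Y i)) .H = 0 := fun i => hwt _ _ _ (by norm_num [wt])
  have hEYE : ∀ i, φ (bas .E) (bas (.Y i)) .E = 0 := fun i => hwt _ _ _ (by norm_num [wt])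
  have hEYF : ∀ i, φ (bas .E) (bas (.Y i)) .F = 0 := fun i => hwt _ _ _ (by norm_num [wt])
  have hEYY : ∀ i j, φ (bas .E) (bas (.Y i)) (.Y j) = 0 := fun i j =>
    hwt _ _ _ (by norm_num [wt])
  refine linearMap_ext_bas fun i => linearMap_ext_bas fun j => ?_
  funext k
  rw [cobdry_apply, brgL_bas]
  by_cases hk : wt k = wt i + wt j
  · cases i <;> cases j <;> cases k <;> norm_num [wt] at hk <;>
      simp [brgL_apply, brg, bas_apply, basBrg, wt, primitive, ofBas_bas, halt, hR, hP, hQ, hA,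
        hB, hD, hF, hskew .F .H, hskew .E .H, hskew .F .E, hskew (.X _) .H, hskew (.Y _) .H,
        hskew (.Y _) .E, hskew (.X _) .F, hskew (.Y _) (.X _)]
    all_goals ring
  · rw [hwt i j k hk]
    cases i <;> cases j <;> cases k <;> norm_num [wt] at hk <;>
      simp [brgL_apply, brg, bas_apply, basBrg, wt, primitive, ofBas_bas, hEYH,
        hEYE, hEYF, hEYY]

end Schrodinger

open Schrodinger in
/-- **For every `n ≥ 3`, the second adjoint cohomology of `g_n = sch_n/⟨z⟩` vanishes:
every alternating bilinear 2-cocycle `φ : g_n × g_n → g_n` is a 2-coboundary,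
i.e. `H²(g_n, g_n) = 0`.** -/
theorem H2_adjoint_quotient_schrodinger_eq_zero (n : ℕ) (hn : 3 ≤ n) :
    ∀ φ : G n →ₗ[ℂ] G n →ₗ[ℂ] G n,
      (∀ a, φ a a = 0) →
      (∀ a b c, brgL n a (φ b c) + brgL n b (φ c a) + brgL n c (φ a b) +
        φ a (brgL n b c) + φ b (brgL n c a) + φ c (brgL n a b) = 0) →
      ∃ ω : G n →ₗ[ℂ] G n, ∀ a b,
        φ a b = brgL n (ω a) b + brgL n a (ω b) - ω (brgL n a b) := by
  intro φ halt hφ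
  obtain ⟨ω, hω⟩ := exists_sub_cobdry_commute halt
  have halt' : ∀ a, (φ - cobdry ω) a a = 0 := fun a => by
    rw [LinearMap.sub_apply, LinearMap.sub_apply, halt, cobdry_self, sub_zero]
  have hφ' : IsCocycle (φ - cobdry ω) := IsCocycle.sub hφ (isCocycle_cobdry ω)
  have h := eq_cobdry_primitive halt' hφ' (apply_eq_zero_of_wt_ne halt' hφ' hω)
  refine ⟨primitive (φ - cobdry ω) + ω, fun a b => ?_⟩
  have hab := LinearMap.congr_fun₂ h a b
  rw [LinearMap.sub_apply, LinearMap.sub_apply, sub_eq_iff_eq_add] at hab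
  rw [hab, cobdry_apply, cobdry_apply]
  simp only [LinearMap.add_apply, map_add]
  abel
end

section
/- For every integer n ≥ 2, every sl_2-invariant linear map ω: a → g_n from the abelian ideal a of g_n = sch_n/⟨z⟩ satisfies d¹ω = 0 on a, i.e. [ω(a),b]+[a,ω(b)]-ω([a,b]) = 0 for all a,b ∈ a; consequently the space of sl_2-invariant 2-coboundaries of a with values in g_n is zero. -/
open scoped BigOperators

@[simp]
theorem brgL_apply {n : ℕ} (u v : G n) : brgL n u v = brg u v := rfl

/-- The element `h` acts on the ideal `a` as an involution. -/
theorem actA_hG_actA_hG {n : ℕ} (a : A n) : actA (hG n) (actA (hG n) a) = a := by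
  funext j
  cases j <;> simp [actA, brg, hG, ιA]

/-- Two elements of `g_n` with zero `sl_2`-component commute. -/
theorem brg_eq_zero {n : ℕ} {u v : G n}
    (hu : u .H = 0 ∧ u .E = 0 ∧ u .F = 0) (hv : v .H = 0 ∧ v .E = 0 ∧ v .F = 0) :
    brg u v = 0 := by
  obtain ⟨hu₁, hu₂, hu₃⟩ := hu
  obtain ⟨hv₁, hv₂, hv₃⟩ := hv
  funext j
  cases j <;> simp [brg, hu₁, hu₂, hu₃, hv₁, hv₂, hv₃]

theorem brA_eq_zero {n : ℕ} (a b : A n) : brA a b = 0 := by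
  have h : brg (ιA a) (ιA b) = 0 := brg_eq_zero ⟨rfl, rfl, rfl⟩ ⟨rfl, rfl, rfl⟩
  funext j
  cases j <;> simp [brA, actA, h]

/-- A fixed point of `(ad h)²` has zero `sl_2`-component. -/
theorem sl2_components_eq_zero {n : ℕ} {u : G n} (hu : brg (hG n) (brg (hG n) u) = u) :
    u .H = 0 ∧ u .E = 0 ∧ u .F = 0 := by
  have h₁ := congrFun hu .H
  have h₂ := congrFun hu .E
  have h₃ := congrFun hu .F
  simp [brg, hG] at h₁ h₂ h₃
  refine ⟨h₁.symm, ?_, ?_⟩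
  · linear_combination (1 / 3 : ℂ) * h₂
  · linear_combination (1 / 3 : ℂ) * h₃

/-- An `sl_2`-invariant linear map `a → g_n` has vanishing coboundary. -/
theorem coboundary_eq_zero_of_invariant {n : ℕ} (ω : A n →ₗ[ℂ] G n)
    (hω : ∀ v ∈ sl2G n, ∀ a, brgL n v (ω a) = ω (actA v a)) (a b : A n) :
    brgL n (ω a) (ιA b) + brgL n (ιA a) (ω b) - ω (brA a b) = 0 := by
  have hh : hG n ∈ sl2G n := Submodule.subset_span (by simp)
  have key : ∀ c, ω c .H = 0 ∧ ω c .E = 0 ∧ ω c .F = 0 := fun c =>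
    sl2_components_eq_zero <| by
      rw [← brgL_apply, ← brgL_apply, hω _ hh, hω _ hh, actA_hG_actA_hG]
  rw [brA_eq_zero, map_zero, brgL_apply, brgL_apply,
    brg_eq_zero (key a) ⟨rfl, rfl, rfl⟩, brg_eq_zero ⟨rfl, rfl, rfl⟩ (key b)]
  simp

/-- **For every `n ≥ 2`: every `sl_2`-invariant linear map `ω : a → g_n` satisfies
`d¹ω = 0` on `a`, and consequently the space of `sl_2`-invariant 2-coboundaries of `a`
with values in `g_n` is zero.** -/
theorem invHom_quotient_coboundary_vanishes (n : ℕ) (hn : 2 ≤ n) :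
    (∀ ω : A n →ₗ[ℂ] G n,
      (∀ v ∈ sl2G n, ∀ a, brgL n v (ω a) = ω (actA v a)) →
      ∀ a b, brgL n (ω a) (ιA b) + brgL n (ιA a) (ω b) - ω (brA a b) = 0) ∧
    ∀ φ : A n →ₗ[ℂ] A n →ₗ[ℂ] G n,
      (∃ ω : A n →ₗ[ℂ] G n,
        (∀ v ∈ sl2G n, ∀ a, brgL n v (ω a) = ω (actA v a)) ∧
        ∀ a b, φ a b = brgL n (ω a) (ιA b) + brgL n (ιA a) (ω b) - ω (brA a b)) →
      φ = 0 := by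
  refine ⟨coboundary_eq_zero_of_invariant, ?_⟩
  rintro φ ⟨ω, hω, hφ⟩
  refine LinearMap.ext₂ fun a b => ?_
  rw [hφ, coboundary_eq_zero_of_invariant ω hω]
  rfl
end
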